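/- Let (T,d) be a compact metric space and m a Borel probability measure on T. Let φ be a Young function with φ(1)=1 satisfying, for some R>1, φ(R^k)/φ(R^{k+1}) ≤ φ(R^{k-1})/φ(R^k) for all integers k≥1, and assume M(m,φ) := ∫_T ∫_0^{D(T)} φ^{-1}(1/m(B(t,ε))) dε m(dt) < ∞, where D(T) is the diameter of T. Set φ₊(x) := max(φ(x)−1, 0). Then there exist constants C, K ∈ (0,∞) depending only on φ and R, and a Borel probability measure ν on T×T, such that for every continuous function f : T → ℝ: sup_{s,t∈T, s≠t} φ₊( |f(s)−f(t)| / ( C τ_{m,φ}(s,t) φ₊^{-1}( M(m,φ) / (K τ_{m,φ}(s,t)) ) ) ) ≤ ∫_{T×T} φ₊(f^d(u,v)) ν(du,dv), where φ₊^{-1} is the generalized inverse of φ₊. -/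

import Mathlib

open MeasureTheory ENNReal Filter

noncomputable section

/-- A (finite) Young function: an increasing convex function `φ : [0,∞) → [0,∞)`
with `φ 0 = 0` and `φ x → ∞` as `x → ∞`. -/
def IsYoungFunction (φ : ℝ → ℝ) : Prop :=
  MonotoneOn φ (Set.Ici 0) ∧ ConvexOn ℝ (Set.Ici 0) φ ∧ φ 0 = 0 ∧
    Tendsto φ atTop atTop

/-- Generalized inverse of a Young function, as a map `ℝ≥0∞ → ℝ≥0∞`
(so that in particular `φ⁻¹(∞) = ∞`). -/
def yinv (φ : ℝ → ℝ) (y : ℝ≥0∞) : ℝ≥0∞ :=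
  sInf {x : ℝ≥0∞ | ∃ r : ℝ, 0 ≤ r ∧ x = ENNReal.ofReal r ∧ y ≤ ENNReal.ofReal (φ r)}

/-- The minorizing metric
`τ_{m,φ}(s,t) = max_{x ∈ {s,t}} ∫_0^{d(s,t)} φ⁻¹(1 / m(B(x,ε))) dε`,
with the conventions `1/0 = ∞`, `φ⁻¹(∞) = ∞`. -/
def tauDist {T : Type*} [MetricSpace T] [MeasurableSpace T]
    (m : Measure T) (φ : ℝ → ℝ) (s t : T) : ℝ≥0∞ :=
  max (∫⁻ ε in Set.Ioc (0 : ℝ) (dist s t), yinv φ (1 / m (Metric.closedBall s ε)))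
    (∫⁻ ε in Set.Ioc (0 : ℝ) (dist s t), yinv φ (1 / m (Metric.closedBall t ε)))

/-- `f^d(u,v) = |f(u) - f(v)| / d(u,v)`, equal to `0` on the diagonal. -/
def fdiv {T : Type*} [MetricSpace T] (f : T → ℝ) (p : T × T) : ℝ :=
  |f p.1 - f p.2| / dist p.1 p.2

/-- The Luxemburg norm `|g|^ν_χ = inf {a > 0 : ∫ χ(|g|/a) dν ≤ 1}`, with value `∞`
if no such `a` exists. -/
def luxNorm {X : Type*} [MeasurableSpace X] (ν : Measure X) (χ : ℝ → ℝ)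
    (g : X → ℝ) : ℝ≥0∞ :=
  sInf {a : ℝ≥0∞ | ∃ b : ℝ, 0 < b ∧ a = ENNReal.ofReal b ∧
    ∫⁻ u, ENNReal.ofReal (χ (|g u| / b)) ∂ν ≤ 1}

/-- The Amemiya norm `‖g‖^μ_χ = inf_{a>0} a (1 + ∫ χ(|g|/a) dμ)`. -/
def amemiyaNorm {X : Type*} [MeasurableSpace X] (μ : Measure X) (χ : ℝ → ℝ)
    (g : X → ℝ) : ℝ≥0∞ :=
  sInf {c : ℝ≥0∞ | ∃ a : ℝ, 0 < a ∧
    c = ENNReal.ofReal a * (1 + ∫⁻ u, ENNReal.ofReal (χ (|g u| / a)) ∂μ)}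

/-- `r_0(x) = D(T)` and, for `k ≥ 1`,
`r_k(x) = min {ε ≥ 0 : 1 / m(B(x,ε)) ≤ φ(R^k)}` (with `1/0 = ∞`). -/
def rad {T : Type*} [MetricSpace T] [MeasurableSpace T]
    (m : Measure T) (φ : ℝ → ℝ) (R : ℝ) : ℕ → T → ℝ
  | 0, _ => Metric.diam (Set.univ : Set T)
  | k + 1, x => sInf {ε : ℝ | 0 ≤ ε ∧
      1 / m (Metric.closedBall x ε) ≤ ENNReal.ofReal (φ (R ^ (k + 1)))}

/-- `r^l_k(x) = ∑_{i=k}^{l} 2^(i-k) r_i(x)`. -/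
def radl {T : Type*} [MetricSpace T] [MeasurableSpace T]
    (m : Measure T) (φ : ℝ → ℝ) (R : ℝ) (k l : ℕ) (x : T) : ℝ :=
  ∑ i ∈ Finset.Icc k l, (2 : ℝ) ^ (i - k) * rad m φ R i x

/-- The averaging operator `S_k f (x) = (1 / m(B_k(x))) ∫_{B_k(x)} f dm`,
with the convention `0/0 = 0`. -/
def avg {T : Type*} [MetricSpace T] [MeasurableSpace T]
    (m : Measure T) (φ : ℝ → ℝ) (R : ℝ) (k : ℕ) (f : T → ℝ) (x : T) : ℝ :=
  (∫ u in Metric.closedBall x (rad m φ R k x), f u ∂m) /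
    (m (Metric.closedBall x (rad m φ R k x))).toReal

/-- The iterated averaging operator `iterAvg k l f = S_l S_{l-1} ⋯ S_k f` (for `k ≤ l`). -/
def iterAvg {T : Type*} [MetricSpace T] [MeasurableSpace T]
    (m : Measure T) (φ : ℝ → ℝ) (R : ℝ) (k : ℕ) : ℕ → (T → ℝ) → T → ℝ
  | 0, f => avg m φ R 0 f
  | l + 1, f =>
      if l + 1 ≤ k then avg m φ R (l + 1) f
      else avg m φ R (l + 1) (iterAvg m φ R k l f)

/-- The set `{k ≥ 1 : B^l_k(s) ∪ B^l_k(t) ⊆ B°(u, r_{k-1}(u)) for every u ∈ B^l_k(x)}`,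
whose greatest element is `τ_x`. -/
def tauSet {T : Type*} [MetricSpace T] [MeasurableSpace T]
    (m : Measure T) (φ : ℝ → ℝ) (R : ℝ) (l : ℕ) (s t x : T) : Set ℕ :=
  {k : ℕ | 1 ≤ k ∧ ∀ u ∈ Metric.closedBall x (radl m φ R k l x),
    Metric.closedBall s (radl m φ R k l s) ∪ Metric.closedBall t (radl m φ R k l t) ⊆
      Metric.ball u (rad m φ R (k - 1) u)}

/-- For a log-convex sequence, increments over equal lengths increase multiplicatively. -/
theorem mul_le_mul_shift_of_logConvex {a : ℕ → ℝ} (ha : ∀ k, 0 < a k)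
    (h : ∀ k, a (k + 1) * a (k + 1) ≤ a k * a (k + 2)) {x y : ℕ} (hxy : x ≤ y) (n : ℕ) :
    a (x + n) * a y ≤ a x * a (y + n) := by
  have hq : Monotone fun k => a (k + 1) / a k := by
    refine monotone_nat_of_le_succ fun k => ?_
    rw [div_le_div_iff₀ (ha _) (ha _)]
    calc _ ≤ _ := h k
      _ = _ := mul_comm _ _
  induction n with
  | zero => simp
  | succ n ih =>
    have h1 : a (x + n + 1) / a (x + n) ≤ a (y + n + 1) / a (y + n) := hq (by omega)
    have e1 : a (x + n + 1) = a (x + n + 1) / a (x + n) * a (x + n) := by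
      rw [div_mul_cancel₀ _ (ha _).ne']
    have e2 : a (y + n + 1) = a (y + n + 1) / a (y + n) * a (y + n) := by
      rw [div_mul_cancel₀ _ (ha _).ne']
    have hp : 0 ≤ a (x + n + 1) / a (x + n) := (div_pos (ha _) (ha _)).le
    calc a (x + (n + 1)) * a y = a (x + n + 1) / a (x + n) * (a (x + n) * a y) := by
          rw [← mul_assoc, ← e1]; rfl
      _ ≤ a (y + n + 1) / a (y + n) * (a x * a (y + n)) :=
          mul_le_mul h1 ih (mul_pos (ha _) (ha _)).le (hp.trans h1)
      _ = a x * (a (y + n + 1) / a (y + n) * a (y + n)) := by ring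
      _ = a x * a (y + (n + 1)) := by rw [← e2]; rfl

/-- A discrete Gronwall-type estimate for sequences with `P i ≤ 3 * g i + 6 * P (i + 1)`. -/
theorem sum_geometric_weight_le {R : ℝ} (hR : 12 ≤ R) {P g : ℕ → ℝ} (hP : ∀ i, 0 ≤ P i) {k l : ℕ}
    (hkl : k ≤ l) (hl : P l ≤ 3 * g l)
    (h : ∀ i, k ≤ i → i < l → P i ≤ 3 * g i + 6 * P (i + 1)) :
    ∑ i ∈ Finset.Icc k l, R ^ i * P i + R ^ k * P k ≤
      6 * ∑ i ∈ Finset.Icc k l, R ^ i * g i := by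
  revert h
  induction hkl using Nat.decreasingInduction with
  | self =>
    intro h
    have : 0 < R ^ l := by positivity
    simp only [Finset.Icc_self, Finset.sum_singleton]
    nlinarith
  | of_succ k hk ih =>
    intro h
    have ih' := ih fun i hi hil => h i (by omega) hil
    rw [← Finset.add_sum_Ioc_eq_sum_Icc (by omega : k ≤ l),
      ← Finset.add_sum_Ioc_eq_sum_Icc (by omega : k ≤ l)]
    rw [show Finset.Ioc k l = Finset.Icc (k + 1) l from by ext; simp]
    have h0 := h k le_rfl hk
    have hpow : 0 < R ^ k := by positivity
    have h1 : R ^ k * P k ≤ R ^ k * (3 * g k + 6 * P (k + 1)) := by gcongr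
    have h2 : 12 * (R ^ k * P (k + 1)) ≤ R ^ (k + 1) * P (k + 1) := by
      rw [pow_succ]
      nlinarith [mul_nonneg hpow.le (hP (k + 1))]
    linarith

section Young

variable {φ : ℝ → ℝ}

theorem IsYoungFunction.mul_le (hφ : IsYoungFunction φ) {x y : ℝ} (hx : 0 ≤ x) (hxy : x ≤ y) :
    φ x * y ≤ x * φ y := by
  obtain ⟨-, hconv, h0, -⟩ := hφ
  rcases hx.eq_or_lt with rfl | hx
  · simp [h0]
  have hy : 0 < y := hx.trans_le hxy
  have := hconv.2 (Set.mem_Ici.2 le_rfl) (Set.mem_Ici.2 hy.le)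
    (sub_nonneg.2 ((div_le_one hy).2 hxy)) (div_pos hx hy).le (by ring)
  simp only [smul_eq_mul, mul_zero, zero_add, h0] at this
  rw [div_mul_cancel₀ _ hy.ne'] at this
  calc φ x * y ≤ x / y * φ y * y := by gcongr
    _ = x * φ y := by field_simp

theorem IsYoungFunction.le_of_lt (hφ : IsYoungFunction φ) {x y : ℝ} (hy : 0 ≤ y)
    (h : φ x < φ y) : x ≤ y := by
  by_contra! hlt
  exact absurd (hφ.1 (Set.mem_Ici.2 hy) (Set.mem_Ici.2 (hy.trans hlt.le)) hlt.le) (not_le.2 h)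

theorem IsYoungFunction.one_le (hφ : IsYoungFunction φ) (hφ1 : φ 1 = 1) {x : ℝ} (hx : 0 ≤ x)
    (h : 1 ≤ φ x) : 1 ≤ x := by
  by_contra! hlt
  have := hφ.mul_le hx hlt.le
  rw [hφ1] at this
  linarith

theorem IsYoungFunction.one_le_apply (hφ : IsYoungFunction φ) (hφ1 : φ 1 = 1) {x : ℝ}
    (hx : 1 ≤ x) : 1 ≤ φ x := by
  rw [← hφ1]
  exact hφ.1 (Set.mem_Ici.2 zero_le_one) (Set.mem_Ici.2 (zero_le_one.trans hx)) hx

/-- Every value is bounded by a threshold `L` plus a multiple of the truncated Young function. -/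
theorem IsYoungFunction.le_add_mul (hφ : IsYoungFunction φ) {L y : ℝ} (hL : 0 ≤ L)
    (hφL : 1 ≤ φ L) : y ≤ L + L / φ L * max (φ y - 1) 0 := by
  have hpos : 0 < φ L := by linarith
  have hq : 0 ≤ L / φ L := div_nonneg hL hpos.le
  rcases le_total y L with hy | hy
  · have : 0 ≤ L / φ L * max (φ y - 1) 0 := mul_nonneg hq (le_max_right _ _)
    linarith
  · have h1 := hφ.mul_le hL hy
    have h2 : y ≤ L / φ L * φ y := by
      rw [div_mul_eq_mul_div, le_div_iff₀ hpos]
      linarith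
    have h3 : L / φ L ≤ L := div_le_self hL hφL
    have h4 : L / φ L * (φ y - 1) ≤ L / φ L * max (φ y - 1) 0 := by
      gcongr
      exact le_max_left _ _
    linarith

theorem IsYoungFunction.measurable_truncation (hφ : IsYoungFunction φ) {X : Type*}
    [MeasurableSpace X] {g : X → ℝ} (hg : Measurable g) (hg0 : ∀ x, 0 ≤ g x) :
    Measurable fun x => ENNReal.ofReal (max (φ (g x) - 1) 0) := by
  have hmono : Monotone fun x => φ (max x 0) := fun x y hxy =>
    hφ.1 (Set.mem_Ici.2 (le_max_right _ _)) (Set.mem_Ici.2 (le_max_right _ _))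
      (max_le_max_right 0 hxy)
  have h := hmono.measurable.comp hg
  simp only [Function.comp_def, max_eq_left (hg0 _)] at h
  exact ((h.sub_const 1).max measurable_const).ennreal_ofReal

end Young
theorem closedBall_diam_univ {T : Type*} [MetricSpace T] [CompactSpace T] (x : T) :
    Metric.closedBall x (Metric.diam (Set.univ : Set T)) = Set.univ :=
  Set.eq_univ_of_forall fun _ =>
    Metric.dist_le_diam_of_mem isCompact_univ.isBounded (Set.mem_univ _) (Set.mem_univ _)

section Radius

variable {T : Type*} [MetricSpace T] [MeasurableSpace T]

/-- The least radius for which the closed ball around `x` has measure at least `c`. -/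
def ballRadius (m : Measure T) (c : ℝ≥0∞) (x : T) : ℝ :=
  sInf {ε : ℝ | 0 ≤ ε ∧ c ≤ m (Metric.closedBall x ε)}

variable {m : Measure T} {c : ℝ≥0∞} {x y : T}

theorem ballRadius_nonneg : 0 ≤ ballRadius m c x :=
  Real.sInf_nonneg fun _ h => h.1

theorem ballRadius_le {ε : ℝ} (hε : 0 ≤ ε) (h : c ≤ m (Metric.closedBall x ε)) :
    ballRadius m c x ≤ ε :=
  csInf_le ⟨0, fun _ h => h.1⟩ ⟨hε, h⟩

theorem measure_closedBall_lt {ε : ℝ} (hε : 0 ≤ ε) (h : ε < ballRadius m c x) :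
    m (Metric.closedBall x ε) < c := by
  by_contra! hc
  exact absurd (ballRadius_le hε hc) (not_le.2 h)

theorem measure_ball_ballRadius_le : m (Metric.ball x (ballRadius m c x)) ≤ c := by
  have hmono : Monotone fun n : ℕ =>
      Metric.closedBall x (ballRadius m c x - 1 / ((n : ℝ) + 1)) := fun a b hab =>
    Metric.closedBall_subset_closedBall
      (sub_le_sub_left (one_div_le_one_div_of_le (by positivity) (by gcongr)) _)
  have hsub : Metric.ball x (ballRadius m c x) ⊆
      ⋃ n : ℕ, Metric.closedBall x (ballRadius m c x - 1 / ((n : ℝ) + 1)) := by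
    intro y hy
    obtain ⟨n, hn⟩ := exists_nat_one_div_lt (sub_pos.2 (Metric.mem_ball.1 hy))
    exact Set.mem_iUnion.2 ⟨n, Metric.mem_closedBall.2 (by linarith)⟩
  refine (measure_mono hsub).trans ?_
  rw [hmono.measure_iUnion]
  refine iSup_le fun n => ?_
  rcases lt_or_ge (ballRadius m c x - 1 / ((n : ℝ) + 1)) 0 with h | h
  · rw [Metric.closedBall_eq_empty.2 h, measure_empty]
    exact zero_le
  · exact (measure_closedBall_lt h (sub_lt_self _ (by positivity))).le

variable [CompactSpace T]

variable [IsProbabilityMeasure m]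

theorem diam_mem_radii (hc : c ≤ 1) (x : T) : Metric.diam (Set.univ : Set T) ∈
    {ε : ℝ | 0 ≤ ε ∧ c ≤ m (Metric.closedBall x ε)} :=
  ⟨Metric.diam_nonneg, by rwa [closedBall_diam_univ, measure_univ]⟩

theorem ballRadius_le_diam (hc : c ≤ 1) :
    ballRadius m c x ≤ Metric.diam (Set.univ : Set T) :=
  ballRadius_le Metric.diam_nonneg (diam_mem_radii (m := m) hc x).2

theorem le_measure_closedBall_of_lt (hc : c ≤ 1) {ε : ℝ} (h : ballRadius m c x < ε) :
    c ≤ m (Metric.closedBall x ε) := by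
  obtain ⟨δ, hδ, hlt⟩ := exists_lt_of_csInf_lt ⟨_, diam_mem_radii (m := m) hc x⟩ h
  exact hδ.2.trans (measure_mono (Metric.closedBall_subset_closedBall hlt.le))

variable [BorelSpace T]

theorem le_measure_closedBall_ballRadius (hc : c ≤ 1) :
    c ≤ m (Metric.closedBall x (ballRadius m c x)) := by
  have hanti : Antitone fun n : ℕ =>
      Metric.closedBall x (ballRadius m c x + 1 / ((n : ℝ) + 1)) := fun a b hab =>
    Metric.closedBall_subset_closedBall
      (add_le_add_right (one_div_le_one_div_of_le (by positivity) (by gcongr)) _)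
  have hsub : (⋂ n : ℕ, Metric.closedBall x (ballRadius m c x + 1 / ((n : ℝ) + 1))) ⊆
      Metric.closedBall x (ballRadius m c x) := by
    intro y hy
    rw [Set.mem_iInter] at hy
    refine Metric.mem_closedBall.2 (le_of_forall_pos_lt_add fun δ hδ => ?_)
    obtain ⟨n, hn⟩ := exists_nat_one_div_lt hδ
    exact (Metric.mem_closedBall.1 (hy n)).trans_lt (by linarith)
  refine le_trans ?_ (measure_mono hsub)
  rw [hanti.measure_iInter (fun n => Metric.isClosed_closedBall.measurableSet.nullMeasurableSet)
    ⟨0, measure_ne_top _ _⟩]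
  exact le_iInf fun n => le_measure_closedBall_of_lt hc (lt_add_of_pos_right _ (by positivity))

theorem ballRadius_le_add_dist (hc : c ≤ 1) (x y : T) :
    ballRadius m c x ≤ ballRadius m c y + dist x y := by
  refine ballRadius_le (add_nonneg ballRadius_nonneg dist_nonneg) ?_
  refine (le_measure_closedBall_ballRadius (x := y) hc).trans (measure_mono ?_)
  exact Metric.closedBall_subset_closedBall' (by rw [dist_comm y x])

theorem continuous_ballRadius (hc : c ≤ 1) : Continuous (ballRadius m c) := by
  refine (LipschitzWith.of_dist_le_mul (K := 1) fun x y => ?_).continuous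
  rw [Real.dist_eq, NNReal.coe_one, one_mul, abs_le]
  have h1 := ballRadius_le_add_dist (m := m) hc x y
  have h2 := ballRadius_le_add_dist (m := m) hc y x
  rw [dist_comm] at h2
  constructor <;> linarith

end Radius
section Transport

/-- The integrand `φ₊ (f^d)` of the theorem. -/
def youngQuotient {T : Type*} [MetricSpace T] (φ : ℝ → ℝ) (f : T → ℝ) (p : T × T) : ℝ≥0∞ :=
  ENNReal.ofReal (max (φ (fdiv f p) - 1) 0)

theorem edist_le_young {T : Type*} [MetricSpace T] {φ : ℝ → ℝ} (hφ : IsYoungFunction φ) {L : ℝ}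
    (hL : 0 ≤ L) (hφL : 1 ≤ φ L) (f : T → ℝ) (p : T × T) :
    edist (f p.1) (f p.2) ≤ ENNReal.ofReal (L * dist p.1 p.2) +
      ENNReal.ofReal (L / φ L) * (ENNReal.ofReal (dist p.1 p.2) * youngQuotient φ f p) := by
  have hq : 0 ≤ L / φ L := div_nonneg hL (zero_le_one.trans hφL)
  rw [youngQuotient, ← ENNReal.ofReal_mul dist_nonneg, ← ENNReal.ofReal_mul hq,
    ← ENNReal.ofReal_add (mul_nonneg hL dist_nonneg)
      (mul_nonneg hq (mul_nonneg dist_nonneg (le_max_right _ _))), edist_dist, Real.dist_eq]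
  refine ENNReal.ofReal_le_ofReal ?_
  rcases eq_or_ne p.1 p.2 with h | h
  · simp [h]
  have hd : 0 < dist p.1 p.2 := dist_pos.2 h
  have hy := hφ.le_add_mul (y := fdiv f p) hL hφL
  calc |f p.1 - f p.2| = fdiv f p * dist p.1 p.2 := by rw [fdiv, div_mul_cancel₀ _ hd.ne']
    _ ≤ (L + L / φ L * max (φ (fdiv f p) - 1) 0) * dist p.1 p.2 := by gcongr
    _ = _ := by ring

variable {T : Type*} [MetricSpace T] [CompactSpace T] [MeasurableSpace T] [BorelSpace T]

theorem measurable_youngQuotient {φ : ℝ → ℝ} (hφ : IsYoungFunction φ) {f : T → ℝ}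
    (hf : Continuous f) : Measurable (youngQuotient φ f) := by
  refine hφ.measurable_truncation (g := fdiv f) ?_ fun p => div_nonneg (abs_nonneg _) dist_nonneg
  exact ((hf.comp continuous_fst).sub (hf.comp continuous_snd)).abs.measurable.div
    continuous_dist.measurable

theorem edist_integral_le_lintegral_edist (γ : Measure (T × T)) [IsProbabilityMeasure γ]
    {f : T → ℝ} (hf : Continuous f) :
    edist (∫ x, f x ∂γ.fst) (∫ x, f x ∂γ.snd) ≤ ∫⁻ p, edist (f p.1) (f p.2) ∂γ := by
  have h1 : Integrable (fun p : T × T => f p.1) γ :=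
    (hf.comp continuous_fst).integrable_of_hasCompactSupport (HasCompactSupport.of_compactSpace _)
  have h2 : Integrable (fun p : T × T => f p.2) γ :=
    (hf.comp continuous_snd).integrable_of_hasCompactSupport (HasCompactSupport.of_compactSpace _)
  rw [Measure.fst, Measure.snd,
    integral_map measurable_fst.aemeasurable hf.measurable.aestronglyMeasurable,
    integral_map measurable_snd.aemeasurable hf.measurable.aestronglyMeasurable,
    edist_eq_enorm_sub, ← integral_sub h1 h2]
  simp_rw [edist_eq_enorm_sub]
  exact enorm_integral_le_lintegral_enorm _

/-- The averages of `f` for two coupled measures are close if the coupling moves points at most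
by `ρ`, up to an error controlled by the difference quotients of `f`. -/
theorem edist_integral_le_young {φ : ℝ → ℝ} (hφ : IsYoungFunction φ) {L ρ : ℝ} (hL : 0 ≤ L)
    (hφL : 1 ≤ φ L) {f : T → ℝ} (hf : Continuous f) (γ : Measure (T × T))
    [IsProbabilityMeasure γ] (hρ : ∀ᵐ p ∂γ, dist p.1 p.2 ≤ ρ) :
    edist (∫ x, f x ∂γ.fst) (∫ x, f x ∂γ.snd) ≤ ENNReal.ofReal (L * ρ) +
      ENNReal.ofReal (L / φ L) *
        ∫⁻ p, ENNReal.ofReal (dist p.1 p.2) * youngQuotient φ f p ∂γ := by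
  calc _ ≤ ∫⁻ p, edist (f p.1) (f p.2) ∂γ := edist_integral_le_lintegral_edist γ hf
    _ ≤ ∫⁻ p, ENNReal.ofReal (L * ρ) + ENNReal.ofReal (L / φ L) *
        (ENNReal.ofReal (dist p.1 p.2) * youngQuotient φ f p) ∂γ := by
      refine lintegral_mono_ae ?_
      filter_upwards [hρ] with p hp
      refine (edist_le_young hφ hL hφL f p).trans ?_
      gcongr
    _ = _ := by
      rw [lintegral_add_left measurable_const, lintegral_const, measure_univ, mul_one,
        lintegral_const_mul' _ _ ENNReal.ofReal_ne_top]

end Transport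
section Smoothing

variable {T : Type*} [MetricSpace T] [MeasurableSpace T]

/-- The transition density, with respect to `m`, of the averaging operator over the balls
`B(x, r x)`. -/
def ballKernel (m : Measure T) (r : T → ℝ) (p : T × T) : ℝ≥0∞ :=
  {p : T × T | dist p.1 p.2 ≤ r p.1}.indicator
    (fun p => (m (Metric.closedBall p.1 (r p.1)))⁻¹) p

/-- The measure controlling one averaging step over the closed balls `B(x, r x)`. -/
def closedBallMeasure (m : Measure T) (r : T → ℝ) : Measure (T × T) :=
  (m.prod m).withDensity fun p => ENNReal.ofReal (r p.1) * ballKernel m r p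

/-- The measure controlling transport inside the open balls of radius `r x`. -/
def openBallMeasure (m : Measure T) (r : T → ℝ) (b : ℝ≥0∞) : Measure (T × T) :=
  (m.prod m).withDensity fun p =>
    ENNReal.ofReal (r p.1) * {p : T × T | dist p.1 p.2 < r p.1}.indicator (fun _ => b) p

variable {m : Measure T} {r : T → ℝ}

theorem ballKernel_of_lt {p : T × T} (h : r p.1 < dist p.1 p.2) : ballKernel m r p = 0 := by
  rw [ballKernel, Set.indicator_of_notMem]
  exact not_le.2 h

variable [BorelSpace T] [IsProbabilityMeasure m]

theorem lintegral_ballKernel (u : T) (hu : m (Metric.closedBall u (r u)) ≠ 0) :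
    ∫⁻ v, ballKernel m r (u, v) ∂m = 1 := by
  have : (fun v => ballKernel m r (u, v)) = (Metric.closedBall u (r u)).indicator
      (fun _ => (m (Metric.closedBall u (r u)))⁻¹) := by
    ext v
    simp only [ballKernel, Set.indicator, Set.mem_ofPred_eq, Metric.mem_closedBall, dist_comm v u]
  rw [this, lintegral_indicator_const Metric.isClosed_closedBall.measurableSet,
    ENNReal.inv_mul_cancel hu (measure_ne_top _ _)]

variable [CompactSpace T]

theorem measurableSet_dist_le (hr : Continuous r) :
    MeasurableSet {p : T × T | dist p.1 p.2 ≤ r p.1} :=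
  (isClosed_le continuous_dist (hr.comp continuous_fst)).measurableSet

theorem measurableSet_dist_lt (hr : Continuous r) :
    MeasurableSet {p : T × T | dist p.1 p.2 < r p.1} :=
  (isOpen_lt continuous_dist (hr.comp continuous_fst)).measurableSet

theorem measurable_ballKernel (hr : Continuous r) : Measurable (ballKernel m r) := by
  refine Measurable.indicator ?_ (measurableSet_dist_le hr)
  refine Measurable.inv (Measurable.comp (g := fun u => m (Metric.closedBall u (r u))) ?_
    measurable_fst)
  have h := measurable_measure_prodMk_left (ν := m) (measurableSet_dist_le hr)
  convert h using 3 with u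
  ext v
  simp [dist_comm]

theorem closedBallMeasure_univ (hr : Continuous r)
    (hm : ∀ u, m (Metric.closedBall u (r u)) ≠ 0) :
    closedBallMeasure m r Set.univ = ∫⁻ u, ENNReal.ofReal (r u) ∂m := by
  have hk := measurable_ballKernel (m := m) hr
  rw [closedBallMeasure, withDensity_apply _ MeasurableSet.univ, setLIntegral_univ,
    lintegral_prod _ (by fun_prop)]
  refine lintegral_congr fun u => ?_
  dsimp only
  rw [lintegral_const_mul' _ _ ENNReal.ofReal_ne_top, lintegral_ballKernel u (hm u), mul_one]

theorem openBallMeasure_univ_le (hr : Continuous r) {b : ℝ≥0∞}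
    (hm : ∀ u, b * m (Metric.ball u (r u)) ≤ 1) :
    openBallMeasure m r b Set.univ ≤ ∫⁻ u, ENNReal.ofReal (r u) ∂m := by
  have hk : Measurable ({p : T × T | dist p.1 p.2 < r p.1}.indicator fun _ => b) :=
    measurable_const.indicator (measurableSet_dist_lt hr)
  rw [openBallMeasure, withDensity_apply _ MeasurableSet.univ, setLIntegral_univ,
    lintegral_prod _ (by fun_prop)]
  refine lintegral_mono fun u => ?_
  dsimp only
  rw [lintegral_const_mul' _ _ ENNReal.ofReal_ne_top]
  refine mul_le_of_le_one_right' ?_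
  have : (fun v => {p : T × T | dist p.1 p.2 < r p.1}.indicator (fun _ => b) (u, v)) =
      (Metric.ball u (r u)).indicator (fun _ => b) := by
    ext v
    simp only [Set.indicator, Set.mem_ofPred_eq, Metric.mem_ball, dist_comm v u]
  rw [this, lintegral_indicator_const Metric.isOpen_ball.measurableSet]
  exact hm u

/-- Averaging a measure `π` over the balls `B(x, r x)`, together with the induced coupling. -/
theorem exists_smoothing_coupling (hr : Continuous r) {c B : ℝ≥0∞} (hc : c ≠ 0)
    (hm : ∀ u, c ≤ m (Metric.closedBall u (r u))) (π : Measure T) [IsProbabilityMeasure π]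
    (hπ : π ≤ B • m) :
    ∃ γ : Measure (T × T), IsProbabilityMeasure γ ∧ γ.fst = π ∧ γ.snd ≤ c⁻¹ • m ∧
      (∀ᵐ p ∂γ, dist p.1 p.2 ≤ r p.1) ∧
      ∀ F : T × T → ℝ≥0∞, Measurable F →
        ∫⁻ p, ENNReal.ofReal (dist p.1 p.2) * F p ∂γ ≤ B * ∫⁻ p, F p ∂closedBallMeasure m r := by
  have hk := measurable_ballKernel (m := m) hr
  have hm0 : ∀ u, m (Metric.closedBall u (r u)) ≠ 0 := fun u =>
    (hc.bot_lt.trans_le (hm u)).ne'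
  set γ := (π.prod m).withDensity (ballKernel m r) with hγ
  have hfst : γ.fst = π := by
    ext A hA
    rw [Measure.fst_apply hA, hγ, withDensity_apply _ (measurable_fst hA), ← Set.prod_univ,
      ← Measure.prod_restrict, lintegral_prod _ hk.aemeasurable]
    simp_rw [Measure.restrict_univ, lintegral_ballKernel _ (hm0 _)]
    simp
  have hprob : IsProbabilityMeasure γ := ⟨by
    rw [← Measure.fst_univ, hfst, measure_univ]⟩
  refine ⟨γ, hprob, hfst, ?_, ?_, fun F hF => ?_⟩
  · refine Measure.le_iff.2 fun A hA => ?_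
    rw [Measure.snd_apply hA, hγ, withDensity_apply _ (measurable_snd hA)]
    calc ∫⁻ p in Prod.snd ⁻¹' A, ballKernel m r p ∂π.prod m
        ≤ ∫⁻ p in Prod.snd ⁻¹' A, c⁻¹ ∂π.prod m := by
          refine lintegral_mono fun p => ?_
          refine (Set.indicator_le_self _ _ p).trans ?_
          exact ENNReal.inv_le_inv.2 (hm _)
      _ = c⁻¹ * m A := by
          rw [setLIntegral_const, ← Set.univ_prod, Measure.prod_prod, measure_univ, one_mul]
      _ = (c⁻¹ • m) A := rfl
  · rw [hγ, ae_withDensity_iff hk]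
    refine ae_of_all _ fun p hp => ?_
    by_contra h
    exact hp (ballKernel_of_lt (not_le.1 h))
  · rw [hγ, closedBallMeasure, lintegral_withDensity_eq_lintegral_mul _ hk (by fun_prop),
      lintegral_withDensity_eq_lintegral_mul _ (by fun_prop) hF]
    have hle : π.prod m ≤ B • m.prod m := by
      rw [← Measure.prod_smul_left]
      exact Measure.prod_mono hπ le_rfl
    calc _ ≤ ∫⁻ p, ((fun p => ENNReal.ofReal (r p.1) * ballKernel m r p) * F) p ∂π.prod m := by
          refine lintegral_mono fun p => ?_
          by_cases h : dist p.1 p.2 ≤ r p.1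
          · simp only [Pi.mul_apply]
            calc _ ≤ ballKernel m r p * (ENNReal.ofReal (r p.1) * F p) := by gcongr
              _ = _ := by ring
          · simp [ballKernel_of_lt (not_le.1 h)]
      _ ≤ _ := lintegral_mono' hle le_rfl
      _ = _ := by rw [lintegral_smul_measure, smul_eq_mul]

/-- Comparison of two measures that are linked through the open balls of radius `r x`. -/
theorem lintegral_prod_le_openBallMeasure (hr : Continuous r) {b B B' C : ℝ≥0∞}
    (hB : B * B' ≤ C * b) {π π' : Measure T} [IsProbabilityMeasure π] [IsProbabilityMeasure π']
    (hπ : π ≤ B • m) (hπ' : π' ≤ B' • m) (hdist : ∀ᵐ p ∂π.prod π', dist p.1 p.2 < r p.1)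
    {F : T × T → ℝ≥0∞} (hF : Measurable F) :
    ∫⁻ p, ENNReal.ofReal (dist p.1 p.2) * F p ∂π.prod π' ≤
      C * ∫⁻ p, F p ∂openBallMeasure m r b := by
  have hs := measurableSet_dist_lt hr
  have hk : Measurable ({p : T × T | dist p.1 p.2 < r p.1}.indicator fun _ => b) :=
    measurable_const.indicator hs
  set S := {p : T × T | dist p.1 p.2 < r p.1} with hS
  have hle : π.prod π' ≤ (B * B') • m.prod m := by
    rw [mul_smul, ← Measure.prod_smul_right, ← Measure.prod_smul_left]
    exact Measure.prod_mono hπ hπ'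
  rw [openBallMeasure, lintegral_withDensity_eq_lintegral_mul _ (by fun_prop) hF]
  calc _ ≤ ∫⁻ p, S.indicator (fun p => ENNReal.ofReal (r p.1) * F p) p ∂π.prod π' := by
        refine lintegral_mono_ae ?_
        filter_upwards [hdist] with p hp
        rw [Set.indicator_of_mem (by exact hp)]
        gcongr
    _ ≤ ∫⁻ p, S.indicator (fun p => ENNReal.ofReal (r p.1) * F p) p ∂(B * B') • m.prod m :=
        lintegral_mono' hle le_rfl
    _ = ∫⁻ p, (B * B') * S.indicator (fun p => ENNReal.ofReal (r p.1) * F p) p ∂m.prod m := by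
        rw [lintegral_smul_measure, smul_eq_mul, lintegral_const_mul _ (by measurability)]
    _ ≤ ∫⁻ p, C * ((fun p => ENNReal.ofReal (r p.1) * S.indicator (fun _ => b) p) * F) p
          ∂m.prod m := by
        refine lintegral_mono fun p => ?_
        by_cases hp : p ∈ S
        · simp only [Set.indicator_of_mem hp, Pi.mul_apply]
          calc _ ≤ (C * b) * (ENNReal.ofReal (r p.1) * F p) := by gcongr
            _ = _ := by ring
        · simp [Set.indicator_of_notMem hp]
    _ = _ := by rw [lintegral_const_mul _ (by fun_prop)]

end Smoothing
section Scales

theorem sum_pow_le_two_mul {R : ℝ} (hR : 2 ≤ R) (n : ℕ) :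
    ∑ k ∈ Finset.range (n + 1), R ^ k ≤ 2 * R ^ n := by
  induction n with
  | zero => simp
  | succ n ih =>
    rw [Finset.sum_range_succ]
    have : 2 * R ^ n ≤ R ^ (n + 1) := by
      rw [pow_succ, mul_comm]
      gcongr
    linarith

theorem sum_pow_le_two_mul_of_forall_le {R : ℝ} (hR : 2 ≤ R) (s : Finset ℕ) {y : ℝ≥0∞}
    (h : ∀ k ∈ s, ENNReal.ofReal (R ^ k) ≤ y) : ∑ k ∈ s, ENNReal.ofReal (R ^ k) ≤ 2 * y := by
  have hR0 : 0 ≤ R := by linarith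
  rcases s.eq_empty_or_nonempty with rfl | hs
  · simp
  · calc ∑ k ∈ s, ENNReal.ofReal (R ^ k)
        ≤ ∑ k ∈ Finset.range (s.max' hs + 1), ENNReal.ofReal (R ^ k) :=
          Finset.sum_le_sum_of_subset fun k hk =>
            Finset.mem_range.2 (Nat.lt_succ_of_le (s.le_max' k hk))
      _ = ENNReal.ofReal (∑ k ∈ Finset.range (s.max' hs + 1), R ^ k) :=
          (ENNReal.ofReal_sum_of_nonneg fun k _ => pow_nonneg hR0 k).symm
      _ ≤ ENNReal.ofReal (2 * R ^ s.max' hs) :=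
          ENNReal.ofReal_le_ofReal (sum_pow_le_two_mul hR _)
      _ = 2 * ENNReal.ofReal (R ^ s.max' hs) := by
          rw [ENNReal.ofReal_mul zero_le_two, ENNReal.ofReal_ofNat]
      _ ≤ 2 * y := by
          gcongr
          exact h _ (s.max'_mem hs)

variable {T : Type*} [MetricSpace T] [MeasurableSpace T]

/-- The least radius for which the ball around `x` has measure at least `1 / φ (R ^ k)`. -/
def scaleRadius (m : Measure T) (φ : ℝ → ℝ) (R : ℝ) (k : ℕ) (x : T) : ℝ :=
  ballRadius m (ENNReal.ofReal (φ (R ^ k)))⁻¹ x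

variable {m : Measure T} {φ : ℝ → ℝ} {R : ℝ}

theorem ofReal_pow_le_yinv (hφ : IsYoungFunction φ) {k : ℕ} {x : T} {ε : ℝ}
    (hε : 0 ≤ ε) (h : ε < scaleRadius m φ R k x) :
    ENNReal.ofReal (R ^ k) ≤ yinv φ (1 / m (Metric.closedBall x ε)) := by
  have hlt := ENNReal.lt_inv_iff_lt_inv.1 (measure_closedBall_lt hε h)
  refine le_sInf ?_
  rintro _ ⟨r, hr, rfl, hle⟩
  rw [one_div] at hle
  exact ENNReal.ofReal_le_ofReal
    (hφ.le_of_lt hr (ENNReal.ofReal_lt_ofReal_iff'.1 (hlt.trans_le hle)).1)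

theorem sum_scaleRadius_le (hφ : IsYoungFunction φ) (hR : 2 ≤ R) (x : T) (δ : ℝ)
    (s : Finset ℕ) :
    ∑ k ∈ s, ENNReal.ofReal (R ^ k * min (scaleRadius m φ R k x) δ) ≤
      2 * ∫⁻ ε in Set.Ioc (0 : ℝ) δ, yinv φ (1 / m (Metric.closedBall x ε)) := by
  have hR0 : 0 ≤ R := by linarith
  have key : ∀ k, ENNReal.ofReal (R ^ k * min (scaleRadius m φ R k x) δ) ≤
      ∫⁻ ε in Set.Ioc (0 : ℝ) δ,
        (Set.Iio (scaleRadius m φ R k x)).indicator (fun _ => ENNReal.ofReal (R ^ k)) ε := by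
    intro k
    rw [lintegral_indicator_const measurableSet_Iio, ENNReal.ofReal_mul (pow_nonneg hR0 _),
      Measure.restrict_apply measurableSet_Iio]
    gcongr
    calc ENNReal.ofReal (min (scaleRadius m φ R k x) δ)
        = volume (Set.Ioo 0 (min (scaleRadius m φ R k x) δ)) := by
          rw [Real.volume_Ioo, sub_zero]
      _ ≤ _ := by
          refine measure_mono fun ε hε => ?_
          exact ⟨hε.2.trans_le (min_le_left _ _), hε.1, hε.2.le.trans (min_le_right _ _)⟩
  refine (Finset.sum_le_sum fun k _ => key k).trans ?_
  rw [← lintegral_finsetSum _ fun k _ => measurable_const.indicator measurableSet_Iio,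
    ← lintegral_const_mul' _ _ (by simp)]
  refine setLIntegral_mono' measurableSet_Ioc fun ε hε => ?_
  classical
  simp only [Set.indicator_apply, ← Finset.sum_filter]
  refine sum_pow_le_two_mul_of_forall_le hR _ fun k hk => ?_
  exact ofReal_pow_le_yinv hφ hε.1.le (Finset.mem_filter.1 hk).2

/-- The unnormalised measure on `T × T` controlling the oscillation of continuous functions. -/
def chainingMeasure (m : Measure T) (φ : ℝ → ℝ) (R : ℝ) : Measure (T × T) :=
  Measure.sum fun k => ENNReal.ofReal (R ^ k) •
    (closedBallMeasure m (scaleRadius m φ R k) +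
      openBallMeasure m (scaleRadius m φ R k) (ENNReal.ofReal (φ (R ^ k))))

theorem sum_lintegral_closedBallMeasure_le (F : T × T → ℝ≥0∞) (s : Finset ℕ) :
    ∑ k ∈ s, ENNReal.ofReal (R ^ k) * ∫⁻ p, F p ∂closedBallMeasure m (scaleRadius m φ R k) ≤
      ∫⁻ p, F p ∂chainingMeasure m φ R := by
  rw [chainingMeasure, lintegral_sum_measure]
  refine le_trans (Finset.sum_le_sum fun k _ => ?_) (ENNReal.sum_le_tsum s)
  rw [lintegral_smul_measure, lintegral_add_measure, smul_eq_mul]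
  gcongr
  exact le_self_add

theorem lintegral_openBallMeasure_le (F : T × T → ℝ≥0∞) (k : ℕ) :
    ENNReal.ofReal (R ^ k) * ∫⁻ p, F p ∂openBallMeasure m (scaleRadius m φ R k)
      (ENNReal.ofReal (φ (R ^ k))) ≤ ∫⁻ p, F p ∂chainingMeasure m φ R := by
  rw [chainingMeasure, lintegral_sum_measure]
  refine le_trans ?_ (ENNReal.le_tsum k)
  rw [lintegral_smul_measure, lintegral_add_measure, smul_eq_mul]
  gcongr
  exact le_add_self

variable [CompactSpace T] [BorelSpace T] [IsProbabilityMeasure m]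

theorem inv_ofReal_le_one (hφ : IsYoungFunction φ) (hφ1 : φ 1 = 1) (hR : 1 ≤ R) (k : ℕ) :
    (ENNReal.ofReal (φ (R ^ k)))⁻¹ ≤ 1 := by
  rw [ENNReal.inv_le_one, ENNReal.one_le_ofReal]
  exact hφ.one_le_apply hφ1 (one_le_pow₀ hR)

theorem continuous_scaleRadius (hφ : IsYoungFunction φ) (hφ1 : φ 1 = 1) (hR : 1 ≤ R) (k : ℕ) :
    Continuous (scaleRadius m φ R k) :=
  continuous_ballRadius (inv_ofReal_le_one hφ hφ1 hR k)

/-- The total integral of the scale radii, weighted geometrically. -/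
theorem tsum_lintegral_scaleRadius_le (hφ : IsYoungFunction φ) (hφ1 : φ 1 = 1) (hR : 2 ≤ R) :
    ∑' k, ENNReal.ofReal (R ^ k) * ∫⁻ x, ENNReal.ofReal (scaleRadius m φ R k x) ∂m ≤
      2 * ∫⁻ x, (∫⁻ ε in Set.Ioc (0 : ℝ) (Metric.diam (Set.univ : Set T)),
        yinv φ (1 / m (Metric.closedBall x ε))) ∂m := by
  have hR1 : 1 ≤ R := by linarith
  have hcont := continuous_scaleRadius (m := m) hφ hφ1 hR1
  refine ENNReal.tsum_le_of_sum_range_le fun n => ?_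
  simp_rw [← lintegral_const_mul' _ _ ENNReal.ofReal_ne_top]
  rw [← lintegral_finsetSum _ fun k _ => by have := (hcont k).measurable; fun_prop,
    ← lintegral_const_mul' _ _ (by simp)]
  refine lintegral_mono fun x => ?_
  refine le_trans (Finset.sum_le_sum fun k _ => ?_)
    (sum_scaleRadius_le hφ hR x (Metric.diam (Set.univ : Set T)) (Finset.range n))
  rw [← ENNReal.ofReal_mul (by positivity), min_eq_left]
  exact ballRadius_le_diam (inv_ofReal_le_one hφ hφ1 hR1 k)

theorem chainingMeasure_univ_le (hφ : IsYoungFunction φ) (hφ1 : φ 1 = 1) (hR : 2 ≤ R) :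
    chainingMeasure m φ R Set.univ ≤
      4 * ∫⁻ x, (∫⁻ ε in Set.Ioc (0 : ℝ) (Metric.diam (Set.univ : Set T)),
        yinv φ (1 / m (Metric.closedBall x ε))) ∂m := by
  have hR1 : 1 ≤ R := by linarith
  have hcont := continuous_scaleRadius (m := m) hφ hφ1 hR1
  rw [chainingMeasure, Measure.sum_apply _ MeasurableSet.univ]
  calc _ ≤ ∑' k, 2 * (ENNReal.ofReal (R ^ k) *
        ∫⁻ x, ENNReal.ofReal (scaleRadius m φ R k x) ∂m) := by
        refine ENNReal.tsum_le_tsum fun k => ?_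
        have h1 := closedBallMeasure_univ (m := m) (hcont k) fun u =>
          ((ENNReal.inv_pos.2 ENNReal.ofReal_ne_top).trans_le
            (le_measure_closedBall_ballRadius (inv_ofReal_le_one hφ hφ1 hR1 k))).ne'
        have h2 := openBallMeasure_univ_le (m := m) (b := ENNReal.ofReal (φ (R ^ k)))
          (hcont k) fun u => by
            calc _ ≤ ENNReal.ofReal (φ (R ^ k)) * (ENNReal.ofReal (φ (R ^ k)))⁻¹ := by
                  gcongr
                  exact measure_ball_ballRadius_le
              _ ≤ 1 := ENNReal.mul_inv_le_one _
        simp only [Measure.smul_apply, Measure.add_apply, smul_eq_mul]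
        rw [h1, mul_left_comm, two_mul]
        gcongr
    _ = 2 * ∑' k, ENNReal.ofReal (R ^ k) *
        ∫⁻ x, ENNReal.ofReal (scaleRadius m φ R k x) ∂m := ENNReal.tsum_mul_left
    _ ≤ 2 * (2 * _) := by
        gcongr
        exact tsum_lintegral_scaleRadius_le hφ hφ1 hR
    _ = _ := by rw [← mul_assoc]; norm_num

end Scales
section Chaining

variable {T : Type*} [MetricSpace T] [CompactSpace T] [MeasurableSpace T] [BorelSpace T]
  {m : Measure T} [IsProbabilityMeasure m] {φ : ℝ → ℝ} {R : ℝ} {f : T → ℝ}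

theorem ofReal_div_mul_le (hφ : IsYoungFunction φ) (hφ1 : φ 1 = 1) (hR : 1 ≤ R)
    (hsuper : ∀ i j, φ (R ^ i) * φ (R ^ j) ≤ φ (R ^ (i + j))) (k n J : ℕ) (X : ℝ≥0∞) :
    ENNReal.ofReal (R ^ (k + n + J) / φ (R ^ (k + n + J))) *
        (ENNReal.ofReal (φ (R ^ (k + n))) * X) ≤
      ENNReal.ofReal (R ^ J * R ^ n / φ (R ^ J)) * (ENNReal.ofReal (R ^ k) * X) := by
  have hpos : ∀ i, 0 < φ (R ^ i) := fun i =>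
    zero_lt_one.trans_le (hφ.one_le_apply hφ1 (one_le_pow₀ hR))
  have hRpos : 0 < R := by linarith
  rw [← mul_assoc, ← mul_assoc,
    ← ENNReal.ofReal_mul (div_nonneg (by positivity) (hpos _).le),
    ← ENNReal.ofReal_mul (div_nonneg (by positivity) (hpos _).le)]
  refine mul_le_mul_left (ENNReal.ofReal_le_ofReal ?_) X
  rw [div_mul_eq_mul_div, div_mul_eq_mul_div, div_le_div_iff₀ (hpos _) (hpos _)]
  have h := hsuper (k + n) J
  generalize φ (R ^ (k + n + J)) = y at h ⊢
  calc _ = R ^ k * R ^ n * R ^ J * (φ (R ^ (k + n)) * φ (R ^ J)) := by ring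
    _ ≤ R ^ k * R ^ n * R ^ J * y := by gcongr
    _ = _ := by ring

/-- One averaging step, from scale `k + 1` to scale `k`. -/
theorem exists_averaging_step (hφ : IsYoungFunction φ) (hφ1 : φ 1 = 1) (hR : 1 ≤ R)
    (hsuper : ∀ i j, φ (R ^ i) * φ (R ^ j) ≤ φ (R ^ (i + j))) (hf : Continuous f) (J k : ℕ)
    {s : T} {p : ℝ} (hp : 0 ≤ p) (π : Measure T) [IsProbabilityMeasure π]
    (hπ : π ≤ ENNReal.ofReal (φ (R ^ (k + 1))) • m) (hs : ∀ᵐ u ∂π, dist u s ≤ p) :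
    ∃ π' : Measure T, IsProbabilityMeasure π' ∧ π' ≤ ENNReal.ofReal (φ (R ^ k)) • m ∧
      (∀ᵐ u ∂π', dist u s ≤ scaleRadius m φ R k s + 2 * p) ∧
      edist (∫ x, f x ∂π) (∫ x, f x ∂π') ≤
        ENNReal.ofReal (R ^ J * (R * (R ^ k * (scaleRadius m φ R k s + 2 * p)))) +
        ENNReal.ofReal (R ^ J * R / φ (R ^ J)) * (ENNReal.ofReal (R ^ k) *
          ∫⁻ q, youngQuotient φ f q ∂closedBallMeasure m (scaleRadius m φ R k)) := by
  have hc := inv_ofReal_le_one hφ hφ1 hR k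
  obtain ⟨γ, hγ, hfst, hsnd, hdist, hcost⟩ := exists_smoothing_coupling (m := m)
    (continuous_scaleRadius hφ hφ1 hR k) (ENNReal.inv_ne_zero.2 ENNReal.ofReal_ne_top)
    (fun u => le_measure_closedBall_ballRadius hc) π hπ
  rw [inv_inv] at hsnd
  have hs' : ∀ᵐ q ∂γ, dist q.1 s ≤ p := by
    rw [← hfst] at hs
    exact ae_of_ae_map measurable_fst.aemeasurable hs
  have hρ : ∀ᵐ q ∂γ, dist q.1 q.2 ≤ scaleRadius m φ R k s + p := by
    filter_upwards [hdist, hs'] with q hq hqs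
    have := ballRadius_le_add_dist (m := m) hc q.1 s
    exact hq.trans (this.trans (add_le_add_right hqs _))
  refine ⟨γ.snd, inferInstance, hsnd, ?_, ?_⟩
  · refine (ae_map_iff measurable_snd.aemeasurable ?_).2 ?_
    · exact (isClosed_le (continuous_id.dist continuous_const) continuous_const).measurableSet
    · filter_upwards [hρ, hs'] with q hq hqs
      have := dist_triangle_left q.2 s q.1
      linarith
  · have hL : 1 ≤ R ^ (k + 1 + J) := one_le_pow₀ hR
    have h := edist_integral_le_young hφ (zero_le_one.trans hL) (hφ.one_le_apply hφ1 hL) hf γ hρ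
    rw [hfst] at h
    refine h.trans (add_le_add ?_ ?_)
    · refine ENNReal.ofReal_le_ofReal ?_
      calc R ^ (k + 1 + J) * (scaleRadius m φ R k s + p)
          ≤ R ^ (k + 1 + J) * (scaleRadius m φ R k s + 2 * p) := by
            gcongr
            linarith
        _ = _ := by ring
    · refine (mul_le_mul_right (hcost _ (measurable_youngQuotient hφ hf)) _).trans ?_
      simpa only [pow_one] using ofReal_div_mul_le hφ hφ1 hR hsuper k 1 J _

/-- Two measures concentrated near `s` and `t` have nearby integrals when the scale radius
at `s` exceeds the distance from `s` to `t`. -/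
theorem edist_integral_le_of_link (hφ : IsYoungFunction φ) (hφ1 : φ 1 = 1) (hR : 1 ≤ R)
    (hlog : ∀ i, φ (R ^ (i + 1)) * φ (R ^ (i + 1)) ≤ φ (R ^ i) * φ (R ^ (i + 2)))
    (hsuper : ∀ i j, φ (R ^ i) * φ (R ^ j) ≤ φ (R ^ (i + j))) (hf : Continuous f) (J k : ℕ)
    {s t : T} {p p' : ℝ} (π π' : Measure T) [IsProbabilityMeasure π] [IsProbabilityMeasure π']
    (hπ : π ≤ ENNReal.ofReal (φ (R ^ (k + 1))) • m)
    (hπ' : π' ≤ ENNReal.ofReal (φ (R ^ (k + 1))) • m) (hs : ∀ᵐ u ∂π, dist u s ≤ p)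
    (ht : ∀ᵐ u ∂π', dist u t ≤ p') (hlink : dist s t + 2 * p + p' < scaleRadius m φ R k s) :
    edist (∫ x, f x ∂π) (∫ x, f x ∂π') ≤
      ENNReal.ofReal (R ^ J * (R ^ 2 * (R ^ k * (dist s t + p + p')))) +
      ENNReal.ofReal (R ^ J * R ^ 2 / φ (R ^ J)) * (ENNReal.ofReal (R ^ k) *
        ∫⁻ q, youngQuotient φ f q ∂openBallMeasure m (scaleRadius m φ R k)
          (ENNReal.ofReal (φ (R ^ k)))) := by
  have hφ0 : ∀ i, 0 ≤ φ (R ^ i) := fun i =>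
    zero_le_one.trans (hφ.one_le_apply hφ1 (one_le_pow₀ hR))
  have hs' : ∀ᵐ q ∂π.prod π', dist q.1 s ≤ p := Measure.quasiMeasurePreserving_fst.ae hs
  have ht' : ∀ᵐ q ∂π.prod π', dist q.2 t ≤ p' := Measure.quasiMeasurePreserving_snd.ae ht
  have hρ : ∀ᵐ q ∂π.prod π', dist q.1 q.2 ≤ dist s t + p + p' := by
    filter_upwards [hs', ht'] with q h1 h2
    have h3 := dist_triangle4 q.1 s t q.2
    rw [dist_comm t] at h3
    linarith
  have hdist : ∀ᵐ q ∂π.prod π', dist q.1 q.2 < scaleRadius m φ R k q.1 := by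
    filter_upwards [hs', hρ] with q h1 h2
    have := ballRadius_le_add_dist (m := m) (inv_ofReal_le_one hφ hφ1 hR k) s q.1
    rw [dist_comm] at this
    change scaleRadius m φ R k s ≤ scaleRadius m φ R k q.1 + _ at this
    linarith
  have hL : 1 ≤ R ^ (k + 2 + J) := one_le_pow₀ hR
  have h := edist_integral_le_young hφ (zero_le_one.trans hL) (hφ.one_le_apply hφ1 hL) hf
    (π.prod π') hρ
  rw [Measure.fst_prod, Measure.snd_prod] at h
  refine h.trans (add_le_add (ENNReal.ofReal_le_ofReal (le_of_eq (by ring))) ?_)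
  have hB : ENNReal.ofReal (φ (R ^ (k + 1))) * ENNReal.ofReal (φ (R ^ (k + 1))) ≤
      ENNReal.ofReal (φ (R ^ (k + 2))) * ENNReal.ofReal (φ (R ^ k)) := by
    rw [← ENNReal.ofReal_mul (hφ0 _), ← ENNReal.ofReal_mul (hφ0 _)]
    exact ENNReal.ofReal_le_ofReal ((hlog k).trans_eq (mul_comm _ _))
  refine (mul_le_mul_right (lintegral_prod_le_openBallMeasure
    (continuous_scaleRadius hφ hφ1 hR k) hB hπ hπ' hdist
    (measurable_youngQuotient hφ hf)) _).trans ?_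
  exact ofReal_div_mul_le hφ hφ1 hR hsuper k 2 J _

/-- Iterated averaging around `s` from scale `l` to scale `k`. -/
theorem exists_averaging_chain (hφ : IsYoungFunction φ) (hφ1 : φ 1 = 1) (hR : 1 ≤ R)
    (hsuper : ∀ i j, φ (R ^ i) * φ (R ^ j) ≤ φ (R ^ (i + j))) (hf : Continuous f) (J : ℕ)
    {s : T} {l : ℕ} {p : ℕ → ℝ} (hp0 : ∀ i, 0 ≤ p i) (hpl : p l = scaleRadius m φ R l s)
    (hp : ∀ i < l, p i = scaleRadius m φ R i s + 2 * p (i + 1)) {η : ℝ}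
    (hη : ∀ u, dist u s ≤ scaleRadius m φ R l s → |f u - f s| ≤ η) {k : ℕ} (hk : k ≤ l) :
    ∃ π : Measure T, IsProbabilityMeasure π ∧ π ≤ ENNReal.ofReal (φ (R ^ k)) • m ∧
      (∀ᵐ u ∂π, dist u s ≤ p k) ∧
      edist (f s) (∫ x, f x ∂π) ≤ ENNReal.ofReal η +
        (ENNReal.ofReal (R ^ J * (R * ∑ i ∈ Finset.Ico k l, R ^ i * p i)) +
        ENNReal.ofReal (R ^ J * R / φ (R ^ J)) * ∑ i ∈ Finset.Ico k l, ENNReal.ofReal (R ^ i) *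
          ∫⁻ q, youngQuotient φ f q ∂closedBallMeasure m (scaleRadius m φ R i)) := by
  induction hk using Nat.decreasingInduction with
  | self =>
    have hc := le_measure_closedBall_ballRadius (m := m) (x := s) (inv_ofReal_le_one hφ hφ1 hR l)
    change _ ≤ m (Metric.closedBall s (scaleRadius m φ R l s)) at hc
    set B := Metric.closedBall s (scaleRadius m φ R l s) with hB
    have hB0 : m B ≠ 0 := ((ENNReal.inv_pos.2 ENNReal.ofReal_ne_top).trans_le hc).ne'
    have hprob := ProbabilityTheory.cond_isProbabilityMeasure hB0
    have hae : ∀ᵐ u ∂ProbabilityTheory.cond m B, dist u s ≤ scaleRadius m φ R l s :=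
      ProbabilityTheory.ae_cond_mem Metric.isClosed_closedBall.measurableSet
    refine ⟨ProbabilityTheory.cond m B, hprob, ?_, by rwa [hpl], ?_⟩
    · rw [ProbabilityTheory.cond]
      refine Measure.le_iff.2 fun A _ => ?_
      simp only [Measure.smul_apply, smul_eq_mul]
      gcongr
      · exact ENNReal.inv_le_iff_inv_le.1 hc
      · exact Measure.restrict_le_self
    · rw [Finset.Ico_self]
      simp only [Finset.sum_empty, mul_zero, ENNReal.ofReal_zero, add_zero]
      have hint : Integrable f (ProbabilityTheory.cond m B) :=
        hf.integrable_of_hasCompactSupport (HasCompactSupport.of_compactSpace _)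
      have hle := norm_integral_le_of_norm_le_const (μ := ProbabilityTheory.cond m B)
        (f := fun u => f u - f s) (C := η) (hae.mono fun u hu => hη u hu)
      rw [integral_sub hint (integrable_const _)] at hle
      simp only [integral_const, probReal_univ, one_smul, mul_one] at hle
      rw [edist_comm, edist_dist, dist_eq_norm]
      exact ENNReal.ofReal_le_ofReal hle
  | of_succ k hk ih =>
    obtain ⟨π, hπ, hπm, hs, hcost⟩ := ih
    obtain ⟨π', hπ', hπm', hs', hcost'⟩ :=
      exists_averaging_step hφ hφ1 hR hsuper hf J k (hp0 _) π hπm hs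
    rw [← hp k hk] at hs' hcost'
    refine ⟨π', hπ', hπm', hs', ?_⟩
    have hRpos : 0 < R := by linarith
    have hnn : ∀ i, 0 ≤ R ^ i * p i := fun i => mul_nonneg (by positivity) (hp0 i)
    refine (edist_triangle _ (∫ x, f x ∂π) _).trans ((add_le_add hcost hcost').trans_eq ?_)
    rw [← Finset.add_sum_Ioo_eq_sum_Ico hk, ← Finset.add_sum_Ioo_eq_sum_Ico hk,
      show Finset.Ioo k l = Finset.Ico (k + 1) l from by ext; simp, mul_add R, mul_add (R ^ J),
      ENNReal.ofReal_add, mul_add (ENNReal.ofReal _)]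
    · ring
    · have := hnn k
      positivity
    · have := Finset.sum_nonneg fun i (_ : i ∈ Finset.Ico (k + 1) l) => hnn i
      positivity

end Chaining
section Oscillation

theorem exists_backward_sequence {r : ℕ → ℝ} (hr : ∀ i, 0 ≤ r i) (l : ℕ) :
    ∃ p : ℕ → ℝ, (∀ i, 0 ≤ p i) ∧ p l = r l ∧ ∀ i < l, p i = r i + 2 * p (i + 1) := by
  refine ⟨fun i => ∑ j ∈ Finset.Icc i l, 2 ^ (j - i) * r j,
    fun i => Finset.sum_nonneg fun j _ => mul_nonneg (by positivity) (hr j), by simp,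
    fun i hi => ?_⟩
  simp only
  rw [← Finset.add_sum_Ioc_eq_sum_Icc hi.le, Finset.mul_sum,
    show Finset.Ioc i l = Finset.Icc (i + 1) l from by ext; simp]
  simp only [Nat.sub_self, pow_zero, one_mul]
  congr 1
  refine Finset.sum_congr rfl fun j hj => ?_
  rw [show j - i = j - (i + 1) + 1 by have := Finset.mem_Icc.1 hj; omega, pow_succ]
  ring

theorem sum_scaleRadius_le_real {T : Type*} [MetricSpace T] [MeasurableSpace T] {m : Measure T}
    {φ : ℝ → ℝ} {R : ℝ} (hφ : IsYoungFunction φ) (hR : 2 ≤ R) {x : T} {δ a : ℝ}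
    (hδ : 0 ≤ δ) (ha : 0 ≤ a)
    (h : ∫⁻ ε in Set.Ioc (0 : ℝ) δ, yinv φ (1 / m (Metric.closedBall x ε)) ≤ ENNReal.ofReal a)
    (s : Finset ℕ) :
    ∑ k ∈ s, R ^ k * min (scaleRadius m φ R k x) δ ≤ 2 * a := by
  have hR0 : 0 ≤ R := by linarith
  have hnn : ∀ k ∈ s, 0 ≤ R ^ k * min (scaleRadius m φ R k x) δ := fun k _ =>
    mul_nonneg (pow_nonneg hR0 _) (le_min ballRadius_nonneg hδ)
  rw [← ENNReal.ofReal_le_ofReal_iff (by positivity), ENNReal.ofReal_sum_of_nonneg hnn,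
    ENNReal.ofReal_mul zero_le_two, ENNReal.ofReal_ofNat]
  refine (sum_scaleRadius_le hφ hR x δ s).trans ?_
  gcongr

variable {T : Type*} [MetricSpace T] [CompactSpace T] [MeasurableSpace T] [BorelSpace T]
  {m : Measure T} [IsProbabilityMeasure m] {φ : ℝ → ℝ} {R : ℝ} {f : T → ℝ}

theorem abs_sub_le_of_lintegral_chainingMeasure_le (hφ : IsYoungFunction φ) (hφ1 : φ 1 = 1)
    (hR : 12 ≤ R)
    (hlog : ∀ i, φ (R ^ (i + 1)) * φ (R ^ (i + 1)) ≤ φ (R ^ i) * φ (R ^ (i + 2)))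
    (hsuper : ∀ i j, φ (R ^ i) * φ (R ^ j) ≤ φ (R ^ (i + j))) (hf : Continuous f) (J : ℕ)
    {s t : T} (hst : s ≠ t) {a : ℝ} (ha : 0 ≤ a)
    (hs : ∫⁻ ε in Set.Ioc (0 : ℝ) (dist s t), yinv φ (1 / m (Metric.closedBall s ε)) ≤
      ENNReal.ofReal a)
    (ht : ∫⁻ ε in Set.Ioc (0 : ℝ) (dist s t), yinv φ (1 / m (Metric.closedBall t ε)) ≤
      ENNReal.ofReal a)
    (hA : ∫⁻ q, youngQuotient φ f q ∂chainingMeasure m φ R ≤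
      ENNReal.ofReal (4 * a * φ (R ^ J))) :
    |f s - f t| ≤ 62 * R ^ 2 * R ^ J * a := by
  have hR1 : 1 ≤ R := by linarith
  have hR2 : 2 ≤ R := by linarith
  have hd : 0 < dist s t := dist_pos.2 hst
  set d := dist s t with hd_def
  have hφJ : 0 < φ (R ^ J) := zero_lt_one.trans_le (hφ.one_le_apply hφ1 (one_le_pow₀ hR1))
  refine le_of_forall_pos_le_add fun η hη => ?_
  set r : ℕ → T → ℝ := scaleRadius m φ R with hr
  have hr0 : ∀ i x, 0 ≤ r i x := fun i x => ballRadius_nonneg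
  have hsumS := sum_scaleRadius_le_real hφ hR2 hd.le ha hs
  have hsumT := sum_scaleRadius_le_real hφ hR2 hd.le ha ht
  obtain ⟨δ₁, hδ₁, hf₁⟩ := Metric.continuous_iff.1 hf s (η / 2) (by positivity)
  obtain ⟨δ₂, hδ₂, hf₂⟩ := Metric.continuous_iff.1 hf t (η / 2) (by positivity)
  obtain ⟨l, hl⟩ : ∃ l : ℕ, 2 * a < R ^ l * min (min δ₁ δ₂) d := by
    obtain ⟨l, hl⟩ := pow_unbounded_of_one_lt (2 * a / min (min δ₁ δ₂) d)
      (by linarith : 1 < R)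
    exact ⟨l, (div_lt_iff₀ (by positivity)).1 hl⟩
  have hsmall : ∀ x, R ^ l * min (r l x) d ≤ 2 * a → r l x < min (min δ₁ δ₂) d := by
    intro x hx
    have h1 : min (r l x) d < min (min δ₁ δ₂) d :=
      lt_of_mul_lt_mul_left (hx.trans_lt hl) (by positivity)
    rcases min_lt_iff.1 h1 with h | h
    · exact h
    · exact absurd h (not_lt.2 (min_le_right _ _))
  have hrs := hsmall s (by simpa using hsumS {l})
  have hrt := hsmall t (by simpa using hsumT {l})
  rw [lt_min_iff, lt_min_iff] at hrs hrt
  obtain ⟨p, hp0, hpl, hp⟩ := exists_backward_sequence (fun i => hr0 i s) l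
  obtain ⟨p', hp0', hpl', hp'⟩ := exists_backward_sequence (fun i => hr0 i t) l
  classical
  let linked : ℕ → Prop := fun k =>
    k = 0 ∨ ∃ k', k = k' + 1 ∧ d + 2 * p k + p' k < r k' s
  obtain ⟨k, hkl, hk, hmax⟩ : ∃ k ≤ l, linked k ∧ ∀ i, k < i → i ≤ l → ¬ linked i :=
    ⟨Nat.findGreatest linked l, Nat.findGreatest_le l,
      Nat.findGreatest_spec (P := linked) (Nat.zero_le l) (Or.inl rfl),
      fun i => Nat.findGreatest_is_greatest⟩
  have hfail : ∀ i, k ≤ i → i < l → r i s ≤ d + 2 * p (i + 1) + p' (i + 1) := by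
    intro i hi hil
    by_contra! h
    exact hmax (i + 1) (by omega) hil (Or.inr ⟨i, rfl, h⟩)
  have hsum := sum_geometric_weight_le hR (P := fun i => p i + p' i)
    (g := fun i => min (r i s) d + min (r i t) d) (fun i => add_nonneg (hp0 i) (hp0' i)) hkl
    (by
      rw [hpl, hpl', min_eq_left hrs.2.le, min_eq_left hrt.2.le]
      linarith [hr0 l s, hr0 l t])
    (by
      intro i hi hil
      have h1 := hfail i hi hil
      have h2 : r i t ≤ r i s + d := by
        rw [hd_def, dist_comm]
        exact ballRadius_le_add_dist (inv_ofReal_le_one hφ hφ1 hR1 i) t s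
      rw [hp i hil, hp' i hil]
      have := hr0 i s
      have := hr0 i t
      have := hp0 (i + 1)
      have := hp0' (i + 1)
      rcases min_cases (r i s) d with ⟨e1, e2⟩ | ⟨e1, e2⟩ <;>
      rcases min_cases (r i t) d with ⟨e3, e4⟩ | ⟨e3, e4⟩ <;>
      rw [e1, e3] <;> linarith)
  simp only [mul_add, Finset.sum_add_distrib] at hsum
  have hS := hsumS (Finset.Icc k l)
  have hT := hsumT (Finset.Icc k l)
  change ∑ i ∈ _, R ^ i * min (r i s) d ≤ _ at hS
  change ∑ i ∈ _, R ^ i * min (r i t) d ≤ _ at hT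
  have hIco : ∀ q : ℕ → ℝ, (∀ i, 0 ≤ q i) →
      0 ≤ ∑ i ∈ Finset.Ico k l, R ^ i * q i ∧
      ∑ i ∈ Finset.Ico k l, R ^ i * q i ≤ ∑ i ∈ Finset.Icc k l, R ^ i * q i := fun q hq =>
    ⟨Finset.sum_nonneg fun i _ => mul_nonneg (by positivity) (hq i),
      Finset.sum_le_sum_of_subset_of_nonneg Finset.Ico_subset_Icc_self
        fun i _ _ => mul_nonneg (by positivity) (hq i)⟩
  obtain ⟨hIp0, hIp⟩ := hIco p hp0
  obtain ⟨hIp0', hIp'⟩ := hIco p' hp0'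
  have hpk : 0 ≤ R ^ k * p k := mul_nonneg (by positivity) (hp0 k)
  have hpk' : 0 ≤ R ^ k * p' k := mul_nonneg (by positivity) (hp0' k)
  have hcostA : ∀ (n : ℕ) (X : ℝ≥0∞), X ≤ ∫⁻ q, youngQuotient φ f q ∂chainingMeasure m φ R →
      ENNReal.ofReal (R ^ J * R ^ n / φ (R ^ J)) * X ≤
        ENNReal.ofReal (R ^ J * R ^ n * (4 * a)) := by
    intro n X hX
    calc _ ≤ ENNReal.ofReal (R ^ J * R ^ n / φ (R ^ J)) *
          ENNReal.ofReal (4 * a * φ (R ^ J)) := by gcongr; exact hX.trans hA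
      _ = _ := by
          rw [← ENNReal.ofReal_mul (by positivity)]
          congr 1
          field_simp
  obtain ⟨π, hπ, hπm, hπs, hπc⟩ := exists_averaging_chain (m := m) hφ hφ1 hR1 hsuper hf J hp0 hpl
    hp (fun u hu => (hf₁ u (hu.trans_lt hrs.1.1)).le) hkl
  obtain ⟨π', hπ', hπm', hπt, hπc'⟩ := exists_averaging_chain (m := m) hφ hφ1 hR1 hsuper hf J hp0'
    hpl' hp' (fun u hu => (hf₂ u (hu.trans_lt hrt.1.2)).le) hkl
  have hfinal : ∀ {x y z : ℝ} {X : ℝ≥0∞}, 0 ≤ z →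
      edist x y ≤ ENNReal.ofReal (η / 2) + (ENNReal.ofReal (R ^ J * (R * z)) +
        ENNReal.ofReal (R ^ J * R / φ (R ^ J)) * X) →
      X ≤ ∫⁻ q, youngQuotient φ f q ∂chainingMeasure m φ R →
      |x - y| ≤ η / 2 + (R ^ J * (R * z) + R ^ J * R * (4 * a)) := by
    intro x y z X hz h hX
    have h1 := hcostA 1 X hX
    rw [pow_one] at h1
    rw [← Real.dist_eq, ← ENNReal.ofReal_le_ofReal_iff (by positivity), ← edist_dist,
      ENNReal.ofReal_add (by positivity) (by positivity),
      ENNReal.ofReal_add (by positivity) (by positivity)]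
    exact h.trans (by gcongr)
  have e1 := hfinal hIp0 hπc (sum_lintegral_closedBallMeasure_le _ _)
  have e2 := hfinal hIp0' hπc' (sum_lintegral_closedBallMeasure_le _ _)
  have e3 : |∫ x, f x ∂π - ∫ x, f x ∂π'| ≤ R ^ J * (R ^ 2 * (26 * a)) + R ^ J * R ^ 2 * (4 * a) := by
    rcases hk with rfl | ⟨k', rfl, hlink⟩
    · have hπeq : ∀ μ : Measure T, IsProbabilityMeasure μ →
          μ ≤ ENNReal.ofReal (φ (R ^ 0)) • m → μ = m := by
        intro μ hμ h
        rw [pow_zero, hφ1, ENNReal.ofReal_one, one_smul] at h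
        exact Measure.eq_of_le_of_isProbabilityMeasure h
      rw [hπeq π hπ hπm, hπeq π' hπ' hπm', sub_self, abs_zero]
      positivity
    · have h := edist_integral_le_of_link hφ hφ1 hR1 hlog hsuper hf J k' π π' hπm hπm' hπs hπt hlink
      have hX := lintegral_openBallMeasure_le (m := m) (φ := φ) (R := R) (youngQuotient φ f) k'
      have hdk : R ^ k' * d ≤ 2 * a := by
        have h1 := hsumS {k'}
        rw [Finset.sum_singleton, min_eq_right] at h1
        · exact h1
        · change d ≤ r k' s
          linarith [hp0 (k' + 1), hp0' (k' + 1)]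
      have hstep : ∀ y, 0 ≤ y → R ^ k' * y ≤ R ^ (k' + 1) * y := fun y hy => by
        gcongr
        omega
      have hz : R ^ k' * (dist s t + p (k' + 1) + p' (k' + 1)) ≤ 26 * a := by
        have h1 := hstep _ (hp0 (k' + 1))
        have h2 := hstep _ (hp0' (k' + 1))
        rw [mul_add, mul_add]
        change R ^ k' * d + _ + _ ≤ _
        linarith
      rw [← Real.dist_eq, ← ENNReal.ofReal_le_ofReal_iff (by positivity), ← edist_dist,
        ENNReal.ofReal_add (by positivity) (by positivity)]
      refine h.trans (add_le_add (ENNReal.ofReal_le_ofReal (by gcongr)) (hcostA 2 _ hX))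
  have htri : |f s - f t| ≤ |f s - ∫ x, f x ∂π| + |∫ x, f x ∂π - ∫ x, f x ∂π'| +
      |f t - ∫ x, f x ∂π'| := by
    rw [abs_sub_comm (f t)]
    simpa only [Real.dist_eq] using dist_triangle4 (f s) (∫ x, f x ∂π) (∫ x, f x ∂π') (f t)
  have hRJ : 0 ≤ R ^ J := by positivity
  have hRle : R ≤ R ^ 2 := by nlinarith
  calc |f s - f t| ≤ η + R ^ J * (R * (∑ i ∈ Finset.Ico k l, R ^ i * p i +
        ∑ i ∈ Finset.Ico k l, R ^ i * p' i + 8 * a) + R ^ 2 * (30 * a)) := by linarith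
    _ ≤ η + R ^ J * (R ^ 2 * (32 * a) + R ^ 2 * (30 * a)) := by
        gcongr
        linarith
    _ = _ := by ring

end Oscillation

section Normalization

theorem exists_isProbabilityMeasure_le_smul {X : Type*} [MeasurableSpace X] (μ₀ : Measure X)
    [IsProbabilityMeasure μ₀] {μ : Measure X} {c : ℝ≥0∞} (hc : c ≠ ⊤) (h : μ Set.univ ≤ c) :
    ∃ ν : Measure X, IsProbabilityMeasure ν ∧ μ ≤ c • ν := by
  rcases eq_or_ne μ 0 with rfl | h0
  · exact ⟨μ₀, inferInstance, Measure.zero_le _⟩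
  have hu0 : μ Set.univ ≠ 0 := by simpa using h0
  have hut : μ Set.univ ≠ ⊤ := (h.trans_lt hc.lt_top).ne
  refine ⟨(μ Set.univ)⁻¹ • μ, ⟨?_⟩, ?_⟩
  · rw [Measure.smul_apply, smul_eq_mul, ENNReal.inv_mul_cancel hu0 hut]
  · rw [smul_smul]
    refine Measure.le_iff.2 fun s _ => ?_
    rw [Measure.smul_apply, smul_eq_mul]
    refine le_mul_of_one_le_left zero_le ?_
    rw [← ENNReal.mul_inv_cancel hu0 hut]
    gcongr

theorem IsYoungFunction.one_le_yinv {φ : ℝ → ℝ} (hφ : IsYoungFunction φ) (hφ1 : φ 1 = 1)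
    {y : ℝ≥0∞} (hy : 1 ≤ y) : 1 ≤ yinv φ y := by
  refine le_sInf ?_
  rintro x ⟨r, hr, rfl, h⟩
  rw [ENNReal.one_le_ofReal]
  exact hφ.one_le hφ1 hr (ENNReal.one_le_ofReal.1 (hy.trans h))

theorem lintegral_yinv_ne_zero {T : Type*} [MetricSpace T] [CompactSpace T] [MeasurableSpace T]
    (m : Measure T) [IsProbabilityMeasure m] {φ : ℝ → ℝ} (hφ : IsYoungFunction φ)
    (hφ1 : φ 1 = 1) {s t : T} (hst : s ≠ t) :
    ∫⁻ u, (∫⁻ ε in Set.Ioc (0 : ℝ) (Metric.diam (Set.univ : Set T)),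
      yinv φ (1 / m (Metric.closedBall u ε))) ∂m ≠ 0 := by
  have hD : 0 < Metric.diam (Set.univ : Set T) := (dist_pos.2 hst).trans_le
    (Metric.dist_le_diam_of_mem isCompact_univ.isBounded (Set.mem_univ _) (Set.mem_univ _))
  have h : ∀ u : T, ENNReal.ofReal (Metric.diam (Set.univ : Set T)) ≤
      ∫⁻ ε in Set.Ioc (0 : ℝ) (Metric.diam (Set.univ : Set T)),
        yinv φ (1 / m (Metric.closedBall u ε)) := fun u => by
    calc _ = ∫⁻ ε in Set.Ioc (0 : ℝ) (Metric.diam (Set.univ : Set T)), 1 := by simp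
      _ ≤ _ := lintegral_mono fun ε => hφ.one_le_yinv hφ1 (by
          rw [one_div, ENNReal.one_le_inv]
          exact prob_le_one)
  have h' := lintegral_mono (μ := m) h
  rw [lintegral_const, measure_univ, mul_one] at h'
  exact ((ENNReal.ofReal_pos.2 hD).trans_le h').ne.symm

/-- The least power of `R` at which `φ` reaches the level `y`. -/
theorem IsYoungFunction.exists_pow_level {φ : ℝ → ℝ} (hφ : IsYoungFunction φ) {R : ℝ} (hR : 1 < R)
    {y : ℝ≥0∞} (hy : y ≠ ⊤) :
    ∃ j : ℕ, y ≤ ENNReal.ofReal (φ (R ^ j)) ∧ ∀ i < j, ENNReal.ofReal (φ (R ^ i)) < y := by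
  classical
  have hex : ∃ j : ℕ, y ≤ ENNReal.ofReal (φ (R ^ j)) := by
    obtain ⟨j, hj⟩ := ((hφ.2.2.2.comp (tendsto_pow_atTop_atTop_of_one_lt hR)).eventually_ge_atTop
      y.toReal).exists
    exact ⟨j, ENNReal.le_ofReal_iff_toReal_le hy (ENNReal.toReal_nonneg.trans hj) |>.2 hj⟩
  exact ⟨Nat.find hex, Nat.find_spec hex, fun i hi => not_le.1 (Nat.find_min hex hi)⟩

theorem IsYoungFunction.pow_le_mul_toReal_yinv {φ : ℝ → ℝ} (hφ : IsYoungFunction φ)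
    (hφ1 : φ 1 = 1) {R : ℝ} (hR : 1 ≤ R) {y : ℝ≥0∞} (hy0 : y ≠ 0) (hy : y ≠ ⊤) {j : ℕ}
    (hj : ∀ i < j, ENNReal.ofReal (φ (R ^ i)) < y) :
    R ^ j ≤ R * (yinv (fun x => max (φ x - 1) 0) y).toReal := by
  have hR0 : 0 < R := by linarith
  have hfin : yinv (fun x => max (φ x - 1) 0) y ≠ ⊤ := by
    obtain ⟨r, hr, hr0⟩ := ((hφ.2.2.2.eventually_ge_atTop (y.toReal + 1)).and
      (eventually_ge_atTop 0)).exists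
    have hmem : y ≤ ENNReal.ofReal (max (φ r - 1) 0) := by
      rw [ENNReal.le_ofReal_iff_toReal_le hy (le_max_right _ _)]
      exact le_max_of_le_left (by linarith)
    have hle : yinv (fun x => max (φ x - 1) 0) y ≤ ENNReal.ofReal r := sInf_le ⟨r, hr0, rfl, hmem⟩
    exact (hle.trans_lt ENNReal.ofReal_lt_top).ne
  rw [mul_comm, ← div_le_iff₀ hR0, ← ENNReal.ofReal_le_iff_le_toReal hfin]
  refine le_sInf ?_
  rintro x ⟨r, hr, rfl, h : y ≤ ENNReal.ofReal (max (φ r - 1) 0)⟩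
  refine ENNReal.ofReal_le_ofReal ?_
  rw [div_le_iff₀ hR0]
  have hpos : 0 < max (φ r - 1) 0 := ENNReal.ofReal_pos.1 ((pos_iff_ne_zero.2 hy0).trans_le h)
  have h1 : max (φ r - 1) 0 = φ r - 1 := max_eq_left_of_lt (by
    rcases lt_max_iff.1 hpos with h | h
    · exact h
    · exact absurd h (lt_irrefl _))
  rw [h1] at hpos h
  have hr1 : 1 ≤ r := hφ.one_le hφ1 hr (by linarith)
  cases j with
  | zero => rw [pow_zero]; nlinarith
  | succ j =>
    rw [pow_succ]
    refine mul_le_mul_of_nonneg_right (hφ.le_of_lt hr ?_) hR0.le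
    have := (ENNReal.ofReal_lt_ofReal_iff hpos).1 ((hj j (Nat.lt_succ_self j)).trans_le h)
    linarith

theorem exists_le_mul_and_truncation_le {φ : ℝ → ℝ} (hφ1 : φ 1 = 1) {R : ℝ} (hR : 1 ≤ R)
    {y : ℝ≥0∞} {i : ℕ} (hi : ∀ k < i, ENNReal.ofReal (φ (R ^ k)) < y) :
    ∃ q : ℝ, 0 ≤ q ∧ R ^ i ≤ R * q ∧ ENNReal.ofReal (max (φ q - 1) 0) ≤ y := by
  cases i with
  | zero => exact ⟨1, zero_le_one, by simpa using hR, by simp [hφ1]⟩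
  | succ i =>
    refine ⟨R ^ i, by positivity, (pow_succ' R i).le, ?_⟩
    refine le_trans ?_ (hi i (Nat.lt_succ_self i)).le
    rcases le_total (φ (R ^ i) - 1) 0 with h | h
    · rw [max_eq_right h, ENNReal.ofReal_zero]
      exact zero_le
    · rw [max_eq_left h]
      exact ENNReal.ofReal_le_ofReal (by linarith)

theorem logConvex_and_superMul_pow {φ : ℝ → ℝ} (hφ : IsYoungFunction φ) (hφ1 : φ 1 = 1)
    {R : ℝ} (hR : 1 ≤ R)
    (h : ∀ k : ℕ, 1 ≤ k → φ (R ^ k) / φ (R ^ (k + 1)) ≤ φ (R ^ (k - 1)) / φ (R ^ k)) (n : ℕ) :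
    (∀ i, φ ((R ^ n) ^ (i + 1)) * φ ((R ^ n) ^ (i + 1)) ≤
      φ ((R ^ n) ^ i) * φ ((R ^ n) ^ (i + 2))) ∧
    ∀ i j, φ ((R ^ n) ^ i) * φ ((R ^ n) ^ j) ≤ φ ((R ^ n) ^ (i + j)) := by
  have hpos : ∀ k : ℕ, 0 < φ (R ^ k) := fun k =>
    zero_lt_one.trans_le (hφ.one_le_apply hφ1 (one_le_pow₀ hR))
  have hlog : ∀ k : ℕ, φ (R ^ (k + 1)) * φ (R ^ (k + 1)) ≤ φ (R ^ k) * φ (R ^ (k + 2)) :=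
    fun k => (div_le_div_iff₀ (hpos _) (hpos _)).1 (h (k + 1) (Nat.le_add_left 1 k))
  simp only [← pow_mul]
  refine ⟨fun i => ?_, fun i j => ?_⟩
  · exact mul_le_mul_shift_of_logConvex hpos hlog (x := n * i) (y := n * (i + 1))
      (Nat.mul_le_mul_left n (Nat.le_succ i)) n
  · have := mul_le_mul_shift_of_logConvex hpos hlog (Nat.zero_le (n * j)) (n * i)
    rw [pow_zero, hφ1, one_mul, Nat.zero_add, ← Nat.mul_add, add_comm j] at this
    exact this

end Normalization

/-- Theorem 3 of the paper.  The value `τ_{m,φ}(s,t)` is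
represented by any real `a > 0` with `τ_{m,φ}(s,t) = a`. -/
theorem statement5 (φ : ℝ → ℝ) (hφ : IsYoungFunction φ) (hφ1 : φ 1 = 1)
    (R : ℝ) (hR : 1 < R)
    (hmiau : ∀ k : ℕ, 1 ≤ k → φ (R ^ k) / φ (R ^ (k + 1)) ≤ φ (R ^ (k - 1)) / φ (R ^ k)) :
    ∃ C K : ℝ, 0 < C ∧ 0 < K ∧
      ∀ (T : Type) [MetricSpace T] [CompactSpace T] [MeasurableSpace T] [BorelSpace T]
        (m : Measure T), IsProbabilityMeasure m →
          (∫⁻ u, (∫⁻ ε in Set.Ioc (0 : ℝ) (Metric.diam (Set.univ : Set T)),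
              yinv φ (1 / m (Metric.closedBall u ε))) ∂m) ≠ ⊤ →
          ∃ ν : Measure (T × T), IsProbabilityMeasure ν ∧
            ∀ f : T → ℝ, Continuous f → ∀ s t : T, s ≠ t →
              ∀ a : ℝ, 0 < a → tauDist m φ s t = ENNReal.ofReal a →
                ENNReal.ofReal
                    (max (φ (|f s - f t| /
                      (C * a *
                        (yinv (fun x => max (φ x - 1) 0)
                          ((∫⁻ u, (∫⁻ ε in Set.Ioc (0 : ℝ) (Metric.diam (Set.univ : Set T)),
                              yinv φ (1 / m (Metric.closedBall u ε))) ∂m) /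
                            ENNReal.ofReal (K * a))).toReal)) - 1) 0) ≤
                  ∫⁻ p, ENNReal.ofReal (max (φ (fdiv f p) - 1) 0) ∂ν := by
  obtain ⟨n, hn⟩ := pow_unbounded_of_one_lt 12 hR
  obtain ⟨hlog, hsuper⟩ := logConvex_and_superMul_pow hφ hφ1 hR.le hmiau n
  generalize R ^ n = S at hn hlog hsuper
  have hS0 : 0 < S := by linarith
  refine ⟨62 * S ^ 4, 1, by positivity, one_pos, ?_⟩
  intro T _ _ _ _ m hm hM
  have hmass := chainingMeasure_univ_le (m := m) hφ hφ1 (by linarith : 2 ≤ S)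
  obtain ⟨ν, hν, hle⟩ := exists_isProbabilityMeasure_le_smul (m.prod m)
    (ENNReal.mul_ne_top (by simp) hM) hmass
  refine ⟨ν, hν, fun f hf s t hst a ha hτ => ?_⟩
  have hM0 := lintegral_yinv_ne_zero m hφ hφ1 hst
  generalize ∫⁻ u, (∫⁻ ε in Set.Ioc (0 : ℝ) (Metric.diam (Set.univ : Set T)),
    yinv φ (1 / m (Metric.closedBall u ε))) ∂m = M at *
  change _ ≤ ∫⁻ p, youngQuotient φ f p ∂ν
  have hI := (lintegral_mono' hle (le_refl (youngQuotient φ f))).trans_eq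
    (lintegral_smul_measure _ _)
  generalize ∫⁻ p, youngQuotient φ f p ∂ν = I at *
  rcases eq_or_ne I ⊤ with rfl | hItop
  · exact le_top
  have ha0 : ENNReal.ofReal a ≠ 0 := (ENNReal.ofReal_pos.2 ha).ne'
  rw [one_mul]
  have hy0 : M / ENNReal.ofReal a ≠ 0 := ENNReal.div_ne_zero.2 ⟨hM0, ENNReal.ofReal_ne_top⟩
  have hy : M / ENNReal.ofReal a ≠ ⊤ := ENNReal.div_ne_top hM ha0
  obtain ⟨j, hj, hjmin⟩ := hφ.exists_pow_level (by linarith : 1 < S) hy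
  obtain ⟨i, hi, himin⟩ := hφ.exists_pow_level (by linarith : 1 < S) hItop
  have hP := hφ.pow_le_mul_toReal_yinv hφ1 (by linarith : 1 ≤ S) hy0 hy hjmin
  obtain ⟨q, hq0, hq, hqI⟩ := exists_le_mul_and_truncation_le hφ1 (by linarith : 1 ≤ S) himin
  have hφS : ∀ k : ℕ, 0 ≤ φ (S ^ k) := fun k =>
    zero_le_one.trans (hφ.one_le_apply hφ1 (one_le_pow₀ (by linarith)))
  generalize (yinv (fun x => max (φ x - 1) 0) (M / ENNReal.ofReal a)).toReal = P at *
  have hP0 : 0 < P := pos_of_mul_pos_right ((pow_pos hS0 j).trans_le hP) hS0.le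
  have hosc : |f s - f t| ≤ 62 * S ^ 2 * S ^ (j + i) * a := by
    refine abs_sub_le_of_lintegral_chainingMeasure_le hφ hφ1 hn.le hlog hsuper hf (j + i) hst ha.le
      ((le_max_left _ _).trans_eq hτ) ((le_max_right _ _).trans_eq hτ) (hI.trans ?_)
    have hMa : M ≤ ENNReal.ofReal (a * φ (S ^ j)) := by
      rw [ENNReal.ofReal_mul ha.le, mul_comm]
      exact (ENNReal.div_le_iff ha0 ENNReal.ofReal_ne_top).1 hj
    calc 4 * M * I ≤ 4 * ENNReal.ofReal (a * φ (S ^ j)) * ENNReal.ofReal (φ (S ^ i)) := by gcongr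
      _ = ENNReal.ofReal (4 * (a * φ (S ^ j)) * φ (S ^ i)) := by
          have := mul_nonneg ha.le (hφS j)
          rw [ENNReal.ofReal_mul (p := 4 * _) (by positivity),
            ENNReal.ofReal_mul (p := 4) (by positivity), ENNReal.ofReal_ofNat]
      _ ≤ _ := by
          refine ENNReal.ofReal_le_ofReal ?_
          calc _ = 4 * a * (φ (S ^ j) * φ (S ^ i)) := by ring
            _ ≤ _ := by
                gcongr
                exact hsuper j i
  refine le_trans ?_ hqI
  have hden : 0 < 62 * S ^ 4 * a * P := by positivity
  have hquot : |f s - f t| / (62 * S ^ 4 * a * P) ≤ q := by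
    rw [div_le_iff₀ hden]
    calc _ ≤ _ := hosc
      _ = 62 * S ^ 2 * (S ^ j * S ^ i) * a := by rw [pow_add]
      _ ≤ 62 * S ^ 2 * ((S * P) * (S * q)) * a := by gcongr
      _ = _ := by ring
  refine ENNReal.ofReal_le_ofReal (max_le_max_right 0 (sub_le_sub_right ?_ 1))
  exact hφ.1 (Set.mem_Ici.2 (by positivity)) (Set.mem_Ici.2 hq0) hquot
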